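/- Let (X, 𝔛) be a measurable space, (κ_i)_{i≥1} a sequence of Markov kernels from X to X, and fix a probability measure P* on X. The classical Markov process defined by (κ_i) is L¹-weakly ergodic if and only if for every set Θ, every family E = (P_θ)_{θ∈Θ} of probability measures on X, and every finite subset Θ₀ ⊆ Θ, the trajectory (E_i) satisfies lim_{i→∞} Δ((P_{θ,i})_{θ∈Θ₀}, (P*)_{θ∈Θ₀}) = 0, where (P*)_{θ∈Θ₀} denotes the constant family equal to P* on Θ₀. -/

import Mathlib

open MeasureTheory ProbabilityTheory Filter

noncomputable section

variable {X : Type*} [MeasurableSpace X]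

/-- The total variation norm `‖μ − ν‖₁` of the difference of two (finite)
measures: the sum of the masses of the positive and negative parts of the
Jordan decomposition of `μ − ν`. -/
def tvDist (μ ν : Measure X) : ℝ :=
  ((μ - ν) Set.univ + (ν - μ) Set.univ).toReal

/-- The action `κP` of a Markov kernel on a measure: `(κP)(A) = ∫ κ(x)(A) dP(x)`. -/
def kAct (κ : Kernel X X) (μ : Measure X) : Measure X :=
  μ.bind κ

/-- The classical Markov trajectory: `E₀ = E` and `P_{θ,i} = κ_i P_{θ,i−1}`. -/
def cTraj {Θ : Type*} (κ : ℕ → Kernel X X) (E : Θ → Measure X) :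
    ℕ → Θ → Measure X
  | 0 => E
  | i + 1 => fun θ => kAct (κ (i + 1)) (cTraj κ E i θ)

/-- Iteration `κ_i ⋯ κ₂ κ₁ P` of the process on a single measure. -/
def cIter (κ : ℕ → Kernel X X) (P : Measure X) : ℕ → Measure X
  | 0 => P
  | i + 1 => kAct (κ (i + 1)) (cIter κ P i)

/-- Deficiency `δ(E,F) := inf_{Λ Markov kernel} sup_θ ‖Λ P_θ − Q_θ‖₁`. -/
def cDelta {Θ : Type*} (E F : Θ → Measure X) : ℝ :=
  ⨅ Λ : {κ : Kernel X X // IsMarkovKernel κ}, ⨆ θ : Θ, tvDist (kAct Λ.1 (E θ)) (F θ)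

/-- `Δ(E,F) := max(δ(E,F), δ(F,E))`. -/
def cDist {Θ : Type*} (E F : Θ → Measure X) : ℝ :=
  max (cDelta E F) (cDelta F E)

end

lemma le_measure_sub_add {X : Type*} [MeasurableSpace X] (μ ν : Measure X)
    [IsFiniteMeasure μ] [IsFiniteMeasure ν] : μ ≤ (μ - ν) + ν :=
  Measure.sub_le_iff_le_add.1 le_rfl

lemma tvDist_self {X : Type*} [MeasurableSpace X] (μ : Measure X) : tvDist μ μ = 0 := by
  simp [tvDist]

lemma tvDist_nonneg {X : Type*} [MeasurableSpace X] (μ ν : Measure X) : 0 ≤ tvDist μ ν :=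
  ENNReal.toReal_nonneg

lemma tvDist_comm {X : Type*} [MeasurableSpace X] (μ ν : Measure X) :
    tvDist μ ν = tvDist ν μ := by
  simp [tvDist, add_comm]

lemma measure_sub_univ_triangle {X : Type*} [MeasurableSpace X] (μ ν ρ : Measure X)
    [IsFiniteMeasure μ] [IsFiniteMeasure ν] [IsFiniteMeasure ρ] :
    (μ - ρ) Set.univ ≤ (μ - ν) Set.univ + (ν - ρ) Set.univ := by
  have h : μ - ρ ≤ (μ - ν) + (ν - ρ) := by
    refine Measure.sub_le_of_le_add ?_
    calc μ ≤ (μ - ν) + ν := le_measure_sub_add μ ν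
      _ ≤ (μ - ν) + ((ν - ρ) + ρ) := by gcongr; exact le_measure_sub_add ν ρ
      _ = _ := (add_assoc _ _ _).symm
  simpa using h Set.univ

lemma tvDist_triangle {X : Type*} [MeasurableSpace X] (μ ν ρ : Measure X)
    [IsFiniteMeasure μ] [IsFiniteMeasure ν] [IsFiniteMeasure ρ] :
    tvDist μ ρ ≤ tvDist μ ν + tvDist ν ρ := by
  unfold tvDist
  rw [← ENNReal.toReal_add (by finiteness) (by finiteness)]
  refine ENNReal.toReal_mono (by finiteness) ?_
  calc (μ - ρ) Set.univ + (ρ - μ) Set.univ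
      ≤ ((μ - ν) Set.univ + (ν - ρ) Set.univ) + ((ρ - ν) Set.univ + (ν - μ) Set.univ) :=
        add_le_add (measure_sub_univ_triangle μ ν ρ) (measure_sub_univ_triangle ρ ν μ)
    _ = _ := by ring

lemma isProbabilityMeasure_kAct {X : Type*} [MeasurableSpace X] (κ : Kernel X X)
    [IsMarkovKernel κ] (μ : Measure X) [IsProbabilityMeasure μ] :
    IsProbabilityMeasure (kAct κ μ) := by
  unfold kAct; infer_instance

lemma kAct_const {X : Type*} [MeasurableSpace X] (μ ν : Measure X) [IsProbabilityMeasure μ] :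
    kAct (Kernel.const X ν) μ = ν := by
  simp [kAct]

lemma cTraj_apply {X : Type*} [MeasurableSpace X] {Θ : Type*} (κ : ℕ → Kernel X X)
    (E : Θ → Measure X) (i : ℕ) (θ : Θ) : cTraj κ E i θ = cIter κ (E θ) i := by
  induction i with
  | zero => rfl
  | succ i ih => simp only [cTraj, cIter, ih]

lemma isProbabilityMeasure_cIter {X : Type*} [MeasurableSpace X] {κ : ℕ → Kernel X X}
    (hκ : ∀ i, 1 ≤ i → IsMarkovKernel (κ i)) (P : Measure X) [IsProbabilityMeasure P] (i : ℕ) :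
    IsProbabilityMeasure (cIter κ P i) := by
  induction i with
  | zero => assumption
  | succ i ih =>
    have := hκ (i + 1) (by lia)
    exact isProbabilityMeasure_kAct _ _

lemma cDelta_nonneg {X : Type*} [MeasurableSpace X] {Θ : Type*} (E F : Θ → Measure X) :
    0 ≤ cDelta E F :=
  Real.iInf_nonneg fun _ => Real.iSup_nonneg fun _ => tvDist_nonneg _ _

lemma cDelta_le {X : Type*} [MeasurableSpace X] {Θ : Type*} (E F : Θ → Measure X)
    (Λ : Kernel X X) [hΛ : IsMarkovKernel Λ] :
    cDelta E F ≤ ⨆ θ, tvDist (kAct Λ (E θ)) (F θ) :=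
  ciInf_le (f := fun Λ : {κ : Kernel X X // IsMarkovKernel κ} =>
      ⨆ θ, tvDist (kAct Λ.1 (E θ)) (F θ))
    ⟨0, Set.forall_mem_range.2 fun _ => Real.iSup_nonneg fun _ => tvDist_nonneg _ _⟩ ⟨Λ, hΛ⟩

lemma cDelta_const_right {X : Type*} [MeasurableSpace X] {Θ : Type*} (E : Θ → Measure X)
    (hE : ∀ θ, IsProbabilityMeasure (E θ)) (P : Measure X) [IsProbabilityMeasure P] :
    cDelta E (fun _ => P) = 0 := by
  refine le_antisymm ((cDelta_le _ _ (Kernel.const X P)).trans ?_) (cDelta_nonneg _ _)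
  refine Real.iSup_le (fun θ => ?_) le_rfl
  rw [kAct_const, tvDist_self]

/-- Two members of a family are close in total variation when the family is nearly obtainable
from a constant one. -/
lemma tvDist_le_two_mul_cDelta {X : Type*} [MeasurableSpace X] {Θ : Type*} [Finite Θ]
    (F : Θ → Measure X) (hF : ∀ θ, IsProbabilityMeasure (F θ)) (P : Measure X)
    [IsProbabilityMeasure P] (θ θ' : Θ) :
    tvDist (F θ) (F θ') ≤ 2 * cDelta (fun _ => P) F := by
  have : Nonempty {κ : Kernel X X // IsMarkovKernel κ} := ⟨⟨Kernel.const X P, inferInstance⟩⟩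
  suffices tvDist (F θ) (F θ') / 2 ≤ cDelta (fun _ => P) F by linarith
  refine le_ciInf fun Λ => ?_
  have := Λ.2
  have := isProbabilityMeasure_kAct Λ.1 P
  have hle (η : Θ) : tvDist (kAct Λ.1 P) (F η) ≤ ⨆ η, tvDist (kAct Λ.1 P) (F η) :=
    le_ciSup (f := fun η => tvDist (kAct Λ.1 P) (F η)) (Set.finite_range _).bddAbove η
  have htri := tvDist_triangle (F θ) (kAct Λ.1 P) (F θ')
  rw [tvDist_comm (F θ) (kAct Λ.1 P)] at htri
  linarith [hle θ, hle θ']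

/-- A constant family can be turned into `F` with error at most the spread of `F` around `Q`. -/
lemma cDelta_const_left_le_sum {X : Type*} [MeasurableSpace X] {Θ : Type*} [Fintype Θ]
    (F : Θ → Measure X) (P Q : Measure X) [IsProbabilityMeasure P] [IsProbabilityMeasure Q] :
    cDelta (fun _ => P) F ≤ ∑ θ, tvDist Q (F θ) := by
  refine (cDelta_le _ _ (Kernel.const X Q)).trans (Real.iSup_le (fun θ => ?_) ?_)
  · rw [kAct_const]
    exact Finset.single_le_sum (f := fun θ => tvDist Q (F θ))
      (fun _ _ => tvDist_nonneg _ _) (Finset.mem_univ θ)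
  · exact Finset.sum_nonneg fun _ _ => tvDist_nonneg _ _

/-- A classical Markov process is `L¹`-weakly ergodic iff, for every family of
probability measures and every finite subfamily, the trajectory of the
subfamily converges in `Δ` to the constant family at an arbitrary fixed
probability measure `P*` (i.e. convergence relative to the weak topology). -/
theorem classical_L1_weakly_ergodic_iff.{u} {X : Type*} [MeasurableSpace X]
    (κ : ℕ → Kernel X X) (hκ : ∀ i, 1 ≤ i → IsMarkovKernel (κ i))
    (Pstar : MeasureTheory.Measure X) (hPstar : IsProbabilityMeasure Pstar) :
    (∀ P P' : MeasureTheory.Measure X,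
      IsProbabilityMeasure P → IsProbabilityMeasure P' →
        Tendsto (fun i => tvDist (cIter κ P i) (cIter κ P' i)) atTop (nhds 0)) ↔
    ∀ (Θ : Type u) (E : Θ → MeasureTheory.Measure X),
      (∀ θ, IsProbabilityMeasure (E θ)) → ∀ Θ₀ : Finset Θ,
        Tendsto
          (fun i => cDist (fun θ : Θ₀ => cTraj κ E i θ) (fun _ : Θ₀ => Pstar))
          atTop (nhds 0) := by
  constructor
  · intro h Θ E hE Θ₀
    have hprob (i : ℕ) (P : Measure X) (_ : IsProbabilityMeasure P) :=
      isProbabilityMeasure_cIter hκ P i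
    have hdist (i : ℕ) : cDist (fun θ : Θ₀ => cTraj κ E i θ) (fun _ : Θ₀ => Pstar)
        = cDelta (fun _ : Θ₀ => Pstar) (fun θ : Θ₀ => cIter κ (E θ) i) := by
      simp only [cDist, cTraj_apply]
      rw [cDelta_const_right (fun θ : Θ₀ => cIter κ (E θ) i) (fun θ => hprob i _ (hE θ)),
        max_eq_right (cDelta_nonneg _ _)]
    simp only [hdist]
    refine squeeze_zero (g := fun i => ∑ θ : Θ₀, tvDist (cIter κ Pstar i) (cIter κ (E θ) i))
      (fun _ => cDelta_nonneg _ _) (fun i => ?_) ?_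
    · have := hprob i Pstar hPstar
      exact cDelta_const_left_le_sum _ _ _
    · simpa using tendsto_finsetSum (Finset.univ : Finset Θ₀)
        fun θ _ => h Pstar (E θ) hPstar (hE θ)
  · intro h P P' hP hP'
    let E : ULift.{u} Bool → Measure X := fun b => if b.down then P else P'
    have hE (b) : IsProbabilityMeasure (E b) := by
      simp only [E]; split <;> assumption
    have hlim := (h _ E hE Finset.univ).const_mul 2
    rw [mul_zero] at hlim
    refine squeeze_zero (fun _ => tvDist_nonneg _ _) (fun i => ?_) hlim
    let F : ↥(Finset.univ : Finset (ULift.{u} Bool)) → Measure X := fun θ => cTraj κ E i θ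
    have hF (θ) : IsProbabilityMeasure (F θ) := by
      have := hE θ
      simp only [F, cTraj_apply]
      exact isProbabilityMeasure_cIter hκ _ i
    have hle := tvDist_le_two_mul_cDelta F hF Pstar
      ⟨⟨true⟩, Finset.mem_univ _⟩ ⟨⟨false⟩, Finset.mem_univ _⟩
    simp only [F, cTraj_apply, E, if_true, Bool.false_eq_true, if_false] at hle
    refine hle.trans (mul_le_mul_of_nonneg_left ?_ zero_le_two)
    simp only [cTraj_apply, E]
    exact le_max_right _ _
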